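/- arXiv:1405.1701 — 3 statements merged into one kernel-verified Lean document; each statement's English description precedes it below -/
import Mathlib

section
/- Let 𝓓 = (Ω, 𝓑) be a pliable 4-hypergraph such that for any two points x, y ∈ Ω there is a finite sequence of points x = x_0, x_1, ..., x_n = y with x_{i-1} and x_i collinear for each i. Then for all x, y ∈ Ω the hole stabilizers π_x(𝓓) and π_y(𝓓) are isomorphic groups; indeed they are conjugate subgroups of Sym(Ω): there exists a move sequence f ∈ 𝓛_𝓓 with f^{-1} · π_x(𝓓) · f = π_y(𝓓). -/
open Equiv

variable {Ω : Type*} [DecidableEq Ω] [Fintype Ω]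

/-- Two points of a 4-hypergraph are collinear if they are equal or some line contains both. -/
def HGCollinear (B : Finset (Finset Ω)) (x y : Ω) : Prop :=
  x = y ∨ ∃ b ∈ B, x ∈ b ∧ y ∈ b

/-- A 4-hypergraph is pliable if any two lines sharing three pairwise distinct points are equal. -/
def HGPliable (B : Finset (Finset Ω)) : Prop :=
  ∀ b₁ ∈ B, ∀ b₂ ∈ B, ∀ p q r : Ω, p ≠ q → p ≠ r → q ≠ r →
    p ∈ b₁ → q ∈ b₁ → r ∈ b₁ → p ∈ b₂ → q ∈ b₂ → r ∈ b₂ → b₁ = b₂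

/-- `g` is the elementary move `[x,y]`: it interchanges `x` and `y`, interchanges the
remaining two points of every line through `x` and `y`, and fixes everything else.
For `x = y` it is the identity. -/
def IsElemMove (B : Finset (Finset Ω)) (x y : Ω) (g : Equiv.Perm Ω) : Prop :=
  (x = y ∧ g = 1) ∨
  (x ≠ y ∧ (∃ b ∈ B, x ∈ b ∧ y ∈ b) ∧ g x = y ∧ g y = x ∧
    ∀ z : Ω, z ≠ x → z ≠ y →
      ((∀ b ∈ B, ¬(x ∈ b ∧ y ∈ b ∧ z ∈ b)) → g z = z) ∧
      (∀ b ∈ B, x ∈ b → y ∈ b → z ∈ b →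
        ∀ w ∈ b, w ≠ x → w ≠ y → w ≠ z → g z = w))

/-- `g` is the move sequence `[a₀,…,a_k]` recorded by the list
(elementary moves applied left to right). -/
def IsMoveSeq (B : Finset (Finset Ω)) : List Ω → Equiv.Perm Ω → Prop
  | [], _ => False
  | [_], g => g = 1
  | a :: b :: l, g => ∃ e h : Equiv.Perm Ω,
      IsElemMove B a b e ∧ IsMoveSeq B (b :: l) h ∧ g = h * e

/-- The puzzle set `𝓛_𝓓` of all move sequences. -/
def puzzleSet (B : Finset (Finset Ω)) : Set (Equiv.Perm Ω) :=
  { g | ∃ l : List Ω, IsMoveSeq B l g }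

/-- The hole stabiliser `π_x(𝓓)`: all closed move sequences starting and ending at `x`. -/
def holeStab (B : Finset (Finset Ω)) (x : Ω) : Set (Equiv.Perm Ω) :=
  { g | ∃ l : List Ω, l.head? = some x ∧ l.getLast? = some x ∧ IsMoveSeq B l g }

/-- `(Ω, B)` is a 2-(n,4,λ) design: lines have four points and every pair of distinct
points lies in exactly `lam` lines. -/
def IsTwoDesign (B : Finset (Finset Ω)) (lam : ℕ) : Prop :=
  (∀ b ∈ B, b.card = 4) ∧
  ∀ p q : Ω, p ≠ q → (B.filter fun b => p ∈ b ∧ q ∈ b).card = lam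

/-- Supersimple: any two distinct lines meet in at most two points. -/
def HGSupersimple (B : Finset (Finset Ω)) : Prop :=
  ∀ b₁ ∈ B, ∀ b₂ ∈ B, b₁ ≠ b₂ → (b₁ ∩ b₂).card ≤ 2

/-- `x ∈ overline{a,c}`: `x` is `a`, `c`, or lies on a line containing both `a` and `c`. -/
def HGLineClosure (B : Finset (Finset Ω)) (a c x : Ω) : Prop :=
  x = a ∨ x = c ∨ ∃ b ∈ B, a ∈ b ∧ c ∈ b ∧ x ∈ b

/-- A system of imprimitivity for the hole stabiliser `π_x` acting on `Ω \ {x}`,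
with `ℓ` blocks each of size `k`. -/
def IsHoleBlockSystem (B : Finset (Finset Ω)) (x : Ω) (P : Finset (Finset Ω))
    (k ℓ : ℕ) : Prop :=
  P.card = ℓ ∧ 1 < k ∧ 1 < ℓ ∧ (∀ Δ ∈ P, Δ.card = k) ∧
  (∀ a : Ω, a ≠ x → ∃! Δ : Finset Ω, Δ ∈ P ∧ a ∈ Δ) ∧
  (∀ Δ ∈ P, x ∉ Δ) ∧
  (∀ g ∈ holeStab B x, ∀ Δ ∈ P, Δ.image (⇑g) ∈ P)

/-- `g` is a move sequence leading from `x` to `y`. -/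
def IsMovePath (B : Finset (Finset Ω)) (x y : Ω) (g : Equiv.Perm Ω) : Prop :=
  ∃ l : List Ω, l.head? = some x ∧ l.getLast? = some y ∧ IsMoveSeq B l g

omit [DecidableEq Ω] [Fintype Ω] in
theorem IsElemMove.symm {B : Finset (Finset Ω)} {x y : Ω} {g : Equiv.Perm Ω}
    (h : IsElemMove B x y g) : IsElemMove B y x g⁻¹ := by
  rcases h with ⟨rfl, rfl⟩ | ⟨hne, ⟨b, hb, hx, hy⟩, hgx, hgy, hz⟩
  · exact Or.inl ⟨rfl, inv_one⟩
  · refine Or.inr ⟨hne.symm, ⟨b, hb, hy, hx⟩, ?_, ?_, fun z hzy hzx => ⟨?_, ?_⟩⟩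
    · rw [Equiv.Perm.inv_eq_iff_eq, hgx]
    · rw [Equiv.Perm.inv_eq_iff_eq, hgy]
    · intro hno
      rw [Equiv.Perm.inv_eq_iff_eq]
      exact ((hz z hzx hzy).1 fun b hb h => hno b hb ⟨h.2.1, h.1, h.2.2⟩).symm
    · intro b hb hyb hxb hzb w hw hwy hwx hwz
      rw [Equiv.Perm.inv_eq_iff_eq]
      exact ((hz w hwx hwy).2 b hb hxb hyb hw z hzb hzx hzy hwz.symm).symm

omit [DecidableEq Ω] [Fintype Ω] in
theorem IsMovePath.refl (B : Finset (Finset Ω)) (x : Ω) : IsMovePath B x x 1 :=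
  ⟨[x], rfl, rfl, rfl⟩

omit [DecidableEq Ω] [Fintype Ω] in
theorem IsMovePath.cons {B : Finset (Finset Ω)} {x y z : Ω} {e g : Equiv.Perm Ω}
    (he : IsElemMove B x y e) (hg : IsMovePath B y z g) : IsMovePath B x z (g * e) := by
  obtain ⟨_ | ⟨a, l⟩, hhead, hlast, hl⟩ := hg
  · simp at hhead
  · obtain rfl : a = y := by simpa using hhead
    exact ⟨x :: a :: l, rfl, by simpa using hlast, e, g, he, hl, rfl⟩

omit [DecidableEq Ω] [Fintype Ω] in
theorem IsMovePath.trans {B : Finset (Finset Ω)} {x y z : Ω} {g h : Equiv.Perm Ω}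
    (hg : IsMovePath B x y g) (hh : IsMovePath B y z h) : IsMovePath B x z (h * g) := by
  obtain ⟨l, hhead, hlast, hl⟩ := hg
  induction l generalizing x g with
  | nil => simp at hhead
  | cons a l ih =>
    obtain rfl : a = x := by simpa using hhead
    cases l with
    | nil =>
      obtain rfl : a = y := by simpa using hlast
      obtain rfl : g = 1 := hl
      simpa using hh
    | cons b l =>
      obtain ⟨e, k, he, hk, rfl⟩ := hl
      rw [← mul_assoc]
      exact IsMovePath.cons he (ih rfl (by simpa using hlast) hk)

omit [DecidableEq Ω] [Fintype Ω] in
theorem IsElemMove.isMovePath {B : Finset (Finset Ω)} {x y : Ω} {g : Equiv.Perm Ω}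
    (h : IsElemMove B x y g) : IsMovePath B x y g := by
  simpa using IsMovePath.cons h (IsMovePath.refl B y)

omit [DecidableEq Ω] [Fintype Ω] in
theorem IsMovePath.symm {B : Finset (Finset Ω)} {x y : Ω} {g : Equiv.Perm Ω}
    (hg : IsMovePath B x y g) : IsMovePath B y x g⁻¹ := by
  obtain ⟨l, hhead, hlast, hl⟩ := hg
  induction l generalizing x g with
  | nil => simp at hhead
  | cons a l ih =>
    obtain rfl : a = x := by simpa using hhead
    cases l with
    | nil =>
      obtain rfl : a = y := by simpa using hlast
      obtain rfl : g = 1 := hl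
      simpa using IsMovePath.refl B a
    | cons b l =>
      obtain ⟨e, k, he, hk, rfl⟩ := hl
      rw [mul_inv_rev]
      exact (ih rfl (by simpa using hlast) hk).trans he.symm.isMovePath

omit [Fintype Ω] in
theorem existsUnique_mem_of_card_eq_four {b : Finset Ω} (hb : b.card = 4) {x y z : Ω}
    (hx : x ∈ b) (hy : y ∈ b) (hz : z ∈ b) (hxy : x ≠ y) (hzx : z ≠ x) (hzy : z ≠ y) :
    ∃! w, w ∈ b ∧ w ≠ x ∧ w ≠ y ∧ w ≠ z := by
  have hcard : (((b.erase x).erase y).erase z).card = 1 := by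
    rw [Finset.card_erase_of_mem (by simp [*]),
      Finset.card_erase_of_mem (by simp [*, hxy.symm]), Finset.card_erase_of_mem hx, hb]
  obtain ⟨w, hw⟩ := Finset.card_eq_one.mp hcard
  have key : ∀ v, (v ∈ b ∧ v ≠ x ∧ v ≠ y ∧ v ≠ z) ↔ v = w := fun v => by
    rw [← Finset.mem_singleton, ← hw]
    simp only [Finset.mem_erase]
    tauto
  exact ⟨w, (key w).2 rfl, fun v hv => (key v).1 hv⟩

omit [Fintype Ω] in
theorem exists_isElemMove {B : Finset (Finset Ω)} (hlines : ∀ b ∈ B, b.card = 4)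
    (hpl : HGPliable B) {x y : Ω} (hxy : HGCollinear B x y) : ∃ g, IsElemMove B x y g := by
  rcases eq_or_ne x y with rfl | hne
  · exact ⟨1, Or.inl ⟨rfl, rfl⟩⟩
  let R : Ω → Ω → Prop := fun z w =>
    (z = x ∧ w = y) ∨ (z = y ∧ w = x) ∨
    (z ≠ x ∧ z ≠ y ∧ (∀ b ∈ B, ¬(x ∈ b ∧ y ∈ b ∧ z ∈ b)) ∧ w = z) ∨
    (z ≠ x ∧ z ≠ y ∧ ∃ b ∈ B, x ∈ b ∧ y ∈ b ∧ z ∈ b ∧ w ∈ b ∧ w ≠ x ∧ w ≠ y ∧ w ≠ z)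
  have hex : ∀ z, ∃ w, R z w := by
    intro z
    by_cases hzx : z = x
    · exact ⟨y, Or.inl ⟨hzx, rfl⟩⟩
    by_cases hzy : z = y
    · exact ⟨x, Or.inr (Or.inl ⟨hzy, rfl⟩)⟩
    by_cases hno : ∀ b ∈ B, ¬(x ∈ b ∧ y ∈ b ∧ z ∈ b)
    · exact ⟨z, Or.inr (Or.inr (Or.inl ⟨hzx, hzy, hno, rfl⟩))⟩
    push Not at hno
    obtain ⟨b, hb, hxb, hyb, hzb⟩ := hno
    obtain ⟨w, ⟨hwb, hw⟩, -⟩ :=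
      existsUnique_mem_of_card_eq_four (hlines b hb) hxb hyb hzb hne hzx hzy
    exact ⟨w, Or.inr (Or.inr (Or.inr ⟨hzx, hzy, b, hb, hxb, hyb, hzb, hwb, hw⟩))⟩
  have hsymm : ∀ z w, R z w → R w z := by
    rintro z w (⟨hz, hw⟩ | ⟨hz, hw⟩ | ⟨hzx, hzy, hno, rfl⟩ |
      ⟨hzx, hzy, b, hb, hxb, hyb, hzb, hwb, hwx, hwy, hwz⟩)
    · exact Or.inr (Or.inl ⟨hw, hz⟩)
    · exact Or.inl ⟨hw, hz⟩
    · exact Or.inr (Or.inr (Or.inl ⟨hzx, hzy, hno, rfl⟩))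
    · exact Or.inr (Or.inr (Or.inr
        ⟨hwx, hwy, b, hb, hxb, hyb, hwb, hzb, hzx, hzy, hwz.symm⟩))
  have huniq : ∀ z w w', R z w → R z w' → w = w' := by
    rintro z w w' (⟨hz, hw⟩ | ⟨hz, hw⟩ | ⟨hzx, hzy, hno, hw⟩ |
      ⟨hzx, hzy, b, hb, hxb, hyb, hzb, hw⟩) (⟨hz', hw'⟩ | ⟨hz', hw'⟩ |
      ⟨hzx', hzy', hno', hw'⟩ | ⟨hzx', hzy', b', hb', hxb', hyb', hzb', hw'⟩)
    case inr.inr.inr.inr.inr.inr =>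
      obtain rfl := hpl b hb b' hb' x y z hne hzx.symm hzy.symm hxb hyb hzb hxb' hyb' hzb'
      exact (existsUnique_mem_of_card_eq_four (hlines b hb) hxb hyb hzb hne hzx hzy).unique
        hw hw'
    all_goals grind
  choose f hf using hex
  have hinv : Function.Involutive f := fun z =>
    huniq (f z) _ _ (hf (f z)) (hsymm _ _ (hf z))
  refine ⟨hinv.toPerm, Or.inr ⟨hne, hxy.resolve_left hne,
    huniq x _ _ (hf x) (Or.inl ⟨rfl, rfl⟩), huniq y _ _ (hf y) (Or.inr (Or.inl ⟨rfl, rfl⟩)),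
    fun z hzx hzy => ⟨fun hno => ?_, fun b hb hxb hyb hzb w hwb hwx hwy hwz => ?_⟩⟩⟩
  · exact huniq z _ _ (hf z) (Or.inr (Or.inr (Or.inl ⟨hzx, hzy, hno, rfl⟩)))
  · exact huniq z _ _ (hf z) (Or.inr (Or.inr (Or.inr
      ⟨hzx, hzy, b, hb, hxb, hyb, hzb, hwb, hwx, hwy, hwz⟩)))

omit [Fintype Ω] in
theorem exists_isMovePath {B : Finset (Finset Ω)} (hlines : ∀ b ∈ B, b.card = 4)
    (hpl : HGPliable B) {x y : Ω} {l : List Ω} (hhead : l.head? = some x)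
    (hlast : l.getLast? = some y) (hl : l.IsChain (HGCollinear B)) :
    ∃ g, IsMovePath B x y g := by
  induction l generalizing x with
  | nil => simp at hhead
  | cons a l ih =>
    obtain rfl : a = x := by simpa using hhead
    cases l with
    | nil =>
      obtain rfl : a = y := by simpa using hlast
      exact ⟨1, IsMovePath.refl B a⟩
    | cons b l =>
      rw [List.isChain_cons_cons] at hl
      obtain ⟨e, he⟩ := exists_isElemMove hlines hpl hl.1
      obtain ⟨g, hg⟩ := ih rfl (by simpa using hlast) hl.2
      exact ⟨g * e, IsMovePath.cons he hg⟩

/-- For a pliable 4-hypergraph whose collinearity graph is connected,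
all hole stabilizers are conjugate (hence isomorphic) via an element of the puzzle set. -/
theorem stmt0 (B : Finset (Finset Ω))
    (hlines : ∀ b ∈ B, b.card = 4) (hpl : HGPliable B)
    (hconn : ∀ x y : Ω, ∃ l : List Ω,
      l.head? = some x ∧ l.getLast? = some y ∧ l.Chain' (HGCollinear B)) :
    ∀ x y : Ω, ∃ f ∈ puzzleSet B,
      (fun g => f⁻¹ * g * f) '' holeStab B x = holeStab B y := by
  intro x y
  obtain ⟨l, hhead, hlast, hl⟩ := hconn y x
  obtain ⟨f, hf⟩ := exists_isMovePath hlines hpl hhead hlast hl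
  refine ⟨f, hf.imp fun _ h => h.2.2, Set.Subset.antisymm ?_ fun g hg => ?_⟩
  · rintro _ ⟨g, hg, rfl⟩
    have hg' : IsMovePath B x x g := hg
    have := hf.trans (hg'.trans hf.symm)
    exact this
  · have hg' : IsMovePath B y y g := hg
    have := hf.symm.trans (hg'.trans hf)
    exact ⟨f * g * f⁻¹, this, by group⟩
end

section
/- Let k ≥ 2 and let 𝓓 = (Ω, 𝓑) be the Boolean quadruple system of order 2^k, so Ω = F_2^k. Then the puzzle set 𝓛_𝓓 equals the image of Ω under the regular action, i.e. 𝓛_𝓓 = { σ_ω : ω ∈ F_2^k } where σ_ω is the translation v ↦ v + ω. Consequently, for every ∞ ∈ Ω the hole stabilizer π_∞(𝓓) is the trivial group. -/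
open Equiv

variable {Ω : Type*} [DecidableEq Ω] [Fintype Ω]

/-- The lines of the Boolean quadruple system of order `2^k`: all 4-element subsets of
`F₂^k` whose elements sum to zero. -/
def booleanLines (k : ℕ) : Finset (Finset (Fin k → ZMod 2)) :=
  Finset.univ.filter (fun s => s.card = 4 ∧ s.sum id = 0)

theorem boolean_add_self {k : ℕ} (v : Fin k → ZMod 2) : v + v = 0 := by
  funext i
  exact CharTwo.add_self_eq_zero (v i)

theorem boolean_add_eq_zero_iff {k : ℕ} {v w : Fin k → ZMod 2} : v + w = 0 ↔ v = w := by
  rw [add_eq_zero_iff_eq_neg, neg_eq_of_add_eq_zero_left (boolean_add_self w)]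

theorem mem_booleanLines {k : ℕ} {s : Finset (Fin k → ZMod 2)} :
    s ∈ booleanLines k ↔ s.card = 4 ∧ s.sum id = 0 := by
  simp [booleanLines]

/-- Three distinct points `x`, `y`, `z` and their sum form a line. -/
theorem quadruple_mem_booleanLines {k : ℕ} {x y z : Fin k → ZMod 2}
    (hxy : x ≠ y) (hzx : z ≠ x) (hzy : z ≠ y) :
    {x, y, z, x + y + z} ∈ booleanLines k := by
  have hx : x ≠ x + y + z := fun h => hzy (boolean_add_eq_zero_iff.1
    (by rw [add_assoc] at h; simpa using h)).symm
  have hy : y ≠ x + y + z := fun h => hzx (boolean_add_eq_zero_iff.1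
    (by rw [add_right_comm] at h; simpa using h)).symm
  have hz : z ≠ x + y + z := fun h => hxy (boolean_add_eq_zero_iff.1 (by simpa using h))
  rw [mem_booleanLines]
  constructor
  · rw [Finset.card_eq_succ]
    refine ⟨x, {y, z, x + y + z}, by simp [hxy, hzx.symm, hx], rfl, ?_⟩
    exact Finset.card_eq_three.2 ⟨y, z, x + y + z, hzy.symm, hy, hz, rfl⟩
  · rw [Finset.sum_insert (by simp [hxy, hzx.symm, hx]),
      Finset.sum_insert (by simp [hzy.symm, hy]), Finset.sum_insert (by simp [hz]),
      Finset.sum_singleton]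
    simpa [add_assoc] using boolean_add_self (x + y + z)

/-- The fourth point of a line is the sum of the other three. -/
theorem eq_add_of_mem_booleanLines {k : ℕ} {b : Finset (Fin k → ZMod 2)}
    (hb : b ∈ booleanLines k) {x y z w : Fin k → ZMod 2}
    (hx : x ∈ b) (hy : y ∈ b) (hz : z ∈ b) (hw : w ∈ b)
    (hxy : x ≠ y) (hzx : z ≠ x) (hzy : z ≠ y) (hwx : w ≠ x) (hwy : w ≠ y) (hwz : w ≠ z) :
    w = x + y + z := by
  obtain ⟨hcard, hsum⟩ := mem_booleanLines.1 hb
  have hcard' : ({x, y, z, w} : Finset (Fin k → ZMod 2)).card = 4 := by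
    rw [Finset.card_eq_succ]
    refine ⟨x, {y, z, w}, by simp [hxy, hzx.symm, hwx.symm], rfl, ?_⟩
    exact Finset.card_eq_three.2 ⟨y, z, w, hzy.symm, hwy.symm, hwz.symm, rfl⟩
  have hbeq : {x, y, z, w} = b := by
    refine Finset.eq_of_subset_of_card_le ?_ (by rw [hcard, hcard'])
    simp [Finset.insert_subset_iff, hx, hy, hz, hw]
  rw [← hbeq, Finset.sum_insert (by simp [hxy, hzx.symm, hwx.symm]),
    Finset.sum_insert (by simp [hzy.symm, hwy.symm]), Finset.sum_insert (by simp [hwz.symm]),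
    Finset.sum_singleton] at hsum
  exact (boolean_add_eq_zero_iff.1 (by simpa [add_assoc] using hsum)).symm

/-- The elementary move `[x,y]` is the translation by `x + y`. -/
theorem isElemMove_booleanLines_iff {k : ℕ} (hk : 2 ≤ k) {x y : Fin k → ZMod 2}
    {g : Equiv.Perm (Fin k → ZMod 2)} :
    IsElemMove (booleanLines k) x y g ↔ g = Equiv.addLeft (x + y) := by
  have hadd : x + y + x = y := by
    rw [add_right_comm, boolean_add_self, zero_add]
  have hadd' : x + y + y = x := by
    rw [add_assoc, boolean_add_self, add_zero]
  constructor
  · rintro (⟨rfl, rfl⟩ | ⟨hxy, -, hgx, hgy, hg⟩)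
    · ext1 v
      simp [boolean_add_self]
    · ext1 z
      change g z = x + y + z
      by_cases hzx : z = x
      · rw [hzx, hgx, hadd]
      by_cases hzy : z = y
      · rw [hzy, hgy, hadd']
      refine (hg z hzx hzy).2 _ (quadruple_mem_booleanLines hxy hzx hzy)
        (by simp) (by simp) (by simp) _ (by simp) ?_ ?_ ?_
      · exact fun h => hzy (add_left_cancel (h.trans hadd'.symm))
      · exact fun h => hzx (add_left_cancel (h.trans hadd.symm))
      · exact fun h => hxy (boolean_add_eq_zero_iff.1 (by simpa using h))
  · rintro rfl
    by_cases hxy : x = y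
    · refine Or.inl ⟨hxy, ?_⟩
      ext1 v
      simp [hxy, boolean_add_self]
    refine Or.inr ⟨hxy, ?_, hadd, hadd', fun z hzx hzy => ⟨fun h => ?_, ?_⟩⟩
    · have hlt : ({x, y} : Finset (Fin k → ZMod 2)).card < Fintype.card (Fin k → ZMod 2) := by
        rw [Finset.card_pair hxy, Fintype.card_fun, ZMod.card, Fintype.card_fin]
        exact lt_of_lt_of_le (by norm_num) (Nat.pow_le_pow_right (by norm_num) hk)
      obtain ⟨z, hz⟩ : ∃ z, z ∉ ({x, y} : Finset (Fin k → ZMod 2)) := by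
        by_contra! h
        rw [Finset.eq_univ_iff_forall.2 h, Finset.card_univ] at hlt
        exact lt_irrefl _ hlt
      simp only [Finset.mem_insert, Finset.mem_singleton, not_or] at hz
      exact ⟨_, quadruple_mem_booleanLines hxy hz.1 hz.2, by simp, by simp⟩
    · exact absurd (by simp) (h _ (quadruple_mem_booleanLines hxy hzx hzy))
    · intro b hb hx hy hz w hw hwx hwy hwz
      exact (eq_add_of_mem_booleanLines hb hx hy hz hw hxy hzx hzy hwx hwy hwz).symm

/-- A move sequence is the translation by the sum of its endpoints. -/
theorem isMoveSeq_booleanLines_iff {k : ℕ} (hk : 2 ≤ k) (a : Fin k → ZMod 2)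
    (l : List (Fin k → ZMod 2)) (g : Equiv.Perm (Fin k → ZMod 2)) :
    IsMoveSeq (booleanLines k) (a :: l) g ↔
      g = Equiv.addLeft (a + (a :: l).getLast (List.cons_ne_nil a l)) := by
  induction l generalizing a g with
  | nil =>
    rw [List.getLast_singleton, boolean_add_self]
    simp only [IsMoveSeq]
    rw [Equiv.addLeft_zero]
  | cons b l ih =>
    simp only [IsMoveSeq, ih, isElemMove_booleanLines_iff hk]
    rw [List.getLast_cons (List.cons_ne_nil b l)]
    generalize (b :: l).getLast (List.cons_ne_nil b l) = c
    have hmul : (Equiv.addLeft (b + c) * Equiv.addLeft (a + b) :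
        Equiv.Perm (Fin k → ZMod 2)) = Equiv.addLeft (a + c) := by
      rw [← Equiv.addLeft_add, add_comm b c, add_add_add_comm, add_comm c a, add_assoc,
        boolean_add_self, add_zero]
    constructor
    · rintro ⟨_, _, rfl, rfl, rfl⟩
      exact hmul
    · rintro rfl
      exact ⟨_, _, rfl, rfl, hmul.symm⟩

/-- For the Boolean quadruple system of order `2^k` (`k ≥ 2`), the
puzzle set is exactly the image of the regular action (the translations), and every
hole stabilizer is trivial. -/
theorem stmt3 (k : ℕ) (hk : 2 ≤ k) :
    puzzleSet (booleanLines k) =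
      Set.range (fun ω : Fin k → ZMod 2 =>
        (Equiv.addLeft ω : Equiv.Perm (Fin k → ZMod 2))) ∧
    ∀ x : Fin k → ZMod 2, holeStab (booleanLines k) x = {1} := by
  constructor
  · ext g
    constructor
    · rintro ⟨_ | ⟨a, l⟩, hl⟩
      · exact hl.elim
      · exact ⟨_, ((isMoveSeq_booleanLines_iff hk a l g).1 hl).symm⟩
    · rintro ⟨ω, rfl⟩
      exact ⟨[0, ω], (isMoveSeq_booleanLines_iff hk _ _ _).2 (by simp)⟩
  · intro x
    ext g
    rw [Set.mem_singleton_iff]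
    constructor
    · rintro ⟨_ | ⟨a, l⟩, hhead, hlast, hl⟩
      · exact hl.elim
      · rw [isMoveSeq_booleanLines_iff hk] at hl
        rw [List.getLast?_eq_some_getLast (List.cons_ne_nil a l), Option.some_inj] at hlast
        rw [List.head?_cons, Option.some_inj] at hhead
        rw [hl, hlast, hhead, boolean_add_self, Equiv.addLeft_zero]
    · rintro rfl
      exact ⟨[x], rfl, rfl, rfl⟩
end

section
/- Let n ≥ 7 and let 𝓓 = (Ω, 𝓑) be a supersimple 2-(n,4,1) design. Then n ≡ 1 or 4 (mod 12), and if n ≠ 13 then for every ∞ ∈ Ω the hole stabilizer π_∞(𝓓) is exactly the alternating group on Ω \ {∞}, i.e. π_∞(𝓓) = { g ∈ Sym(Ω) : g(∞) = ∞ and g is an even permutation }. -/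
open Equiv

variable {Ω : Type*} [DecidableEq Ω] [Fintype Ω]

section SteinerSystem

set_option linter.unusedSectionVars false

variable {B : Finset (Finset Ω)}

theorem IsTwoDesign.line_unique (h : IsTwoDesign B 1) {b c : Finset Ω} (hb : b ∈ B) (hc : c ∈ B)
    {p q : Ω} (hpq : p ≠ q) (hpb : p ∈ b) (hqb : q ∈ b) (hpc : p ∈ c) (hqc : q ∈ c) : b = c :=
  Finset.card_le_one.1 (h.2 p q hpq).le b (by simp [*]) c (by simp [*])

theorem IsTwoDesign.exists_line (h : IsTwoDesign B 1) {p q : Ω} (hpq : p ≠ q) :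
    ∃ r s, ({p, q, r, s} : Finset Ω) ∈ B := by
  obtain ⟨b, hb⟩ := Finset.card_pos.1 ((h.2 p q hpq).symm ▸ Nat.one_pos)
  simp only [Finset.mem_filter] at hb
  obtain ⟨hb, hp, hq⟩ := hb
  have hq' : q ∈ b.erase p := Finset.mem_erase.2 ⟨hpq.symm, hq⟩
  have h2 : ((b.erase p).erase q).card = 2 := by
    rw [Finset.card_erase_of_mem hq', Finset.card_erase_of_mem hp, h.1 b hb]
  obtain ⟨r, s, -, hrs⟩ := Finset.card_eq_two.1 h2
  refine ⟨r, s, ?_⟩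
  rwa [← hrs, Finset.insert_erase hq', Finset.insert_erase hp]

theorem IsTwoDesign.line_distinct (h : IsTwoDesign B 1) {p q r s : Ω}
    (hl : ({p, q, r, s} : Finset Ω) ∈ B) :
    p ≠ q ∧ p ≠ r ∧ p ≠ s ∧ q ≠ r ∧ q ≠ s ∧ r ≠ s := by
  have h4 := h.1 _ hl
  refine ⟨?_, ?_, ?_, ?_, ?_, ?_⟩ <;> rintro rfl <;>
    simp only [Finset.mem_insert, Finset.mem_singleton, true_or, or_true,
      Finset.insert_eq_of_mem] at h4 <;>
    exact absurd h4 (Finset.card_le_three.trans_lt (by norm_num)).ne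

theorem IsTwoDesign.card_eq (h : IsTwoDesign B 1) (x : Ω) :
    Fintype.card Ω = 3 * (B.filter fun b => x ∈ b).card + 1 := by
  have key := Finset.card_mul_eq_card_mul (s := Finset.univ.erase x)
    (t := B.filter fun b => x ∈ b) (m := 1) (n := 3) (fun y b => y ∈ b)
    (by
      intro y hy
      rw [← h.2 x y (Finset.ne_of_mem_erase hy).symm, Finset.bipartiteAbove, Finset.filter_filter])
    (by
      intro b hb
      rw [Finset.mem_filter] at hb
      have : (Finset.univ.erase x).bipartiteBelow (fun y b => y ∈ b) b = b.erase x := by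
        ext y; simp [Finset.bipartiteBelow]
      rw [this, Finset.card_erase_of_mem hb.2, h.1 b hb.1])
  rw [Finset.card_erase_of_mem (Finset.mem_univ x), Finset.card_univ] at key
  have : 0 < Fintype.card Ω := Fintype.card_pos_iff.2 ⟨x⟩
  omega

theorem IsTwoDesign.card_mod_twelve (h : IsTwoDesign B 1) [Nonempty Ω] :
    Fintype.card Ω % 12 = 1 ∨ Fintype.card Ω % 12 = 4 := by
  obtain ⟨x⟩ := ‹Nonempty Ω›
  obtain ⟨r, hr⟩ : ∃ r, r = (B.filter fun b => x ∈ b).card := ⟨_, rfl⟩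
  have hx := h.card_eq x
  rw [← hr] at hx
  have key := Finset.card_mul_eq_card_mul (s := Finset.univ) (t := B) (m := r) (n := 4)
    (fun y b => y ∈ b)
    (by
      intro y _
      have := h.card_eq y
      rw [Finset.bipartiteAbove]
      omega)
    (by
      intro b hb
      rw [← h.1 b hb]
      congr 1
      ext y; simp [Finset.bipartiteBelow])
  rw [Finset.card_univ, hx] at key
  rw [hx]
  have h4 : ((3 * r + 1) * r) % 4 = 0 := by omega
  rw [Nat.mul_mod, Nat.add_mod, Nat.mul_mod] at h4
  have : r % 4 < 4 := Nat.mod_lt _ (by norm_num)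
  interval_cases hr4 : r % 4 <;> omega

theorem IsTwoDesign.isElemMove (h : IsTwoDesign B 1) {p q r s : Ω}
    (hl : ({p, q, r, s} : Finset Ω) ∈ B) : IsElemMove B p q (swap p q * swap r s) := by
  obtain ⟨hpq, hpr, hps, hqr, hqs, hrs⟩ := h.line_distinct hl
  refine Or.inr ⟨hpq, ⟨_, hl, by simp, by simp⟩, ?_, ?_, fun z hzp hzq => ⟨fun hz => ?_, ?_⟩⟩
  · simp [swap_apply_of_ne_of_ne hpr hps]
  · simp [swap_apply_of_ne_of_ne hqr hqs]
  · have := hz _ hl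
    simp only [Finset.mem_insert, Finset.mem_singleton, true_or, or_true, true_and] at this
    push Not at this
    simp [swap_apply_of_ne_of_ne this.2.2.1 this.2.2.2, swap_apply_of_ne_of_ne hzp hzq]
  · intro b hb hp hq hz w hw hwp hwq hwz
    obtain rfl := h.line_unique hb hl hpq hp hq (by simp) (by simp)
    simp only [Finset.mem_insert, Finset.mem_singleton] at hz hw
    rcases hz with hz | hz | rfl | rfl
    · exact absurd hz hzp
    · exact absurd hz hzq
    · obtain rfl : w = s := by tauto
      simp [swap_apply_of_ne_of_ne hwp hwq]
    · obtain rfl : w = r := by tauto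
      simp [swap_apply_of_ne_of_ne hwp hwq]

theorem IsTwoDesign.eq_of_isElemMove (h : IsTwoDesign B 1) {p q r s : Ω} {g : Perm Ω}
    (hl : ({p, q, r, s} : Finset Ω) ∈ B) (hg : IsElemMove B p q g) :
    g = swap p q * swap r s := by
  obtain ⟨hpq, hpr, hps, hqr, hqs, hrs⟩ := h.line_distinct hl
  obtain ⟨hpq', -⟩ | ⟨-, -, hgp, hgq, hgz⟩ := hg
  · exact absurd hpq' hpq
  ext z
  by_cases hzp : z = p
  · subst hzp; simp [hgp, swap_apply_of_ne_of_ne hpr hps]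
  by_cases hzq : z = q
  · subst hzq; simp [hgq, swap_apply_of_ne_of_ne hqr hqs]
  by_cases hzr : z = r
  · subst hzr
    rw [(hgz z hzp hzq).2 _ hl (by simp) (by simp) (by simp) s (by simp) hps.symm hqs.symm hrs.symm]
    simp [swap_apply_of_ne_of_ne hps.symm hqs.symm]
  by_cases hzs : z = s
  · subst hzs
    rw [(hgz z hzp hzq).2 _ hl (by simp) (by simp) (by simp) r (by simp) hpr.symm hqr.symm hrs]
    simp [swap_apply_of_ne_of_ne hpr.symm hqr.symm]
  rw [(hgz z hzp hzq).1]
  · simp [swap_apply_of_ne_of_ne hzr hzs, swap_apply_of_ne_of_ne hzp hzq]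
  · rintro b hb ⟨hp, hq, hz⟩
    obtain rfl := h.line_unique hb hl hpq hp hq (by simp) (by simp)
    simp_all

theorem IsTwoDesign.sign_isElemMove (h : IsTwoDesign B 1) {p q : Ω} {g : Perm Ω}
    (hg : IsElemMove B p q g) : Perm.sign g = 1 := by
  by_cases hpq : p = q
  · obtain ⟨-, rfl⟩ | ⟨h', -⟩ := hg
    · simp
    · exact absurd hpq h'
  obtain ⟨r, s, hl⟩ := h.exists_line hpq
  have hd := h.line_distinct hl
  rw [h.eq_of_isElemMove hl hg, Perm.sign_mul, Perm.sign_swap hpq, Perm.sign_swap hd.2.2.2.2.2]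
  simp

theorem IsElemMove.apply_left {p q : Ω} {g : Perm Ω} (hg : IsElemMove B p q g) : g p = q := by
  obtain ⟨rfl, rfl⟩ | ⟨-, -, hgp, -⟩ := hg
  · rfl
  · exact hgp

theorem IsTwoDesign.isMoveSeq (h : IsTwoDesign B 1) :
    ∀ {l : List Ω} {g : Perm Ω}, IsMoveSeq B l g →
      Perm.sign g = 1 ∧ ∀ x ∈ l.head?, g x ∈ l.getLast?
  | [], _, hg => hg.elim
  | [_], _, hg => by cases (show _ = _ from hg); simp
  | a :: b :: l, _, hg => by
    obtain ⟨e, k, he, hk, rfl⟩ := hg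
    obtain ⟨h1, h2⟩ := h.isMoveSeq hk
    refine ⟨by rw [Perm.sign_mul, h1, h.sign_isElemMove he, one_mul], ?_⟩
    simpa [he.apply_left, List.getLast?_cons_cons] using h2

theorem IsMoveSeq.append {x : Ω} {l' : List Ω} {g' : Perm Ω} (hg' : IsMoveSeq B l' g')
    (hx' : l'.head? = some x) : ∀ {l : List Ω} {g : Perm Ω}, IsMoveSeq B l g →
      l.getLast? = some x → ∃ m : List Ω, m.head? = l.head? ∧ m.getLast? = l'.getLast? ∧
        IsMoveSeq B m (g' * g)
  | [], _, hg, _ => hg.elim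
  | [_], _, hg, hx => by
    cases (show _ = _ from hg)
    exact ⟨l', by simp_all, rfl, by simpa⟩
  | a :: b :: l, _, hg, hx => by
    obtain ⟨e, k, he, hk, rfl⟩ := hg
    obtain ⟨m, hm1, hm2, hm⟩ := IsMoveSeq.append hg' hx' hk (by simpa using hx)
    obtain _ | ⟨c, m⟩ := m
    · exact hm.elim
    obtain rfl : c = b := by simpa using hm1
    exact ⟨a :: c :: m, rfl, by simpa using hm2, e, g' * k, he, hm, by rw [mul_assoc]⟩

/-- The hole stabilizer, as a subgroup of the symmetric group. -/
def holeStabSubgroup (B : Finset (Finset Ω)) (x : Ω) : Subgroup (Perm Ω) :=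
  let M : Submonoid (Perm Ω) :=
    { carrier := holeStab B x
      one_mem' := ⟨[x], rfl, rfl, rfl⟩
      mul_mem' := by
        rintro g g' ⟨l, hl, hl', hg⟩ ⟨m, hm, hm', hg'⟩
        obtain ⟨k, hk, hk', hkg⟩ := hg.append hl hg' hm'
        exact ⟨k, hk.trans hm, hk'.trans hl', hkg⟩ }
  { M with
    inv_mem' := by
      intro g hg
      have hg' : g⁻¹ = g ^ (orderOf g - 1) := by
        rw [inv_eq_iff_mul_eq_one, ← pow_succ', Nat.sub_add_cancel (orderOf_pos g),
          pow_orderOf_eq_one]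
      change g⁻¹ ∈ M
      rw [hg']
      exact M.pow_mem hg _ }

theorem swap_commute {a b c d : Ω} (hac : a ≠ c) (had : a ≠ d) (hbc : b ≠ c) (hbd : b ≠ d) :
    Commute (swap a b) (swap c d) := by
  have h := mul_swap_eq_swap_mul (swap a b) c d
  rwa [swap_apply_of_ne_of_ne hac.symm hbc.symm, swap_apply_of_ne_of_ne had.symm hbd.symm] at h

theorem IsTwoDesign.triangle_nodup (h : IsTwoDesign B 1) {x a a₁ a₂ b b₁ b₂ c d : Ω}
    (ha : ({x, a, a₁, a₂} : Finset Ω) ∈ B) (hb : ({x, b, b₁, b₂} : Finset Ω) ∈ B)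
    (hl : ({a, b, c, d} : Finset Ω) ∈ B) (hx : x ∉ ({a, b, c, d} : Finset Ω)) :
    [x, a, a₁, a₂, b, b₁, b₂, c, d].Nodup := by
  have da := h.line_distinct ha
  have db := h.line_distinct hb
  have dl := h.line_distinct hl
  have hal : ∀ y ∈ ({x, a, a₁, a₂} : Finset Ω), y ∈ ({a, b, c, d} : Finset Ω) → y = a := by
    intro y hy hy'
    by_contra hne
    exact hx (h.line_unique ha hl hne hy (by simp) hy' (by simp) ▸ by simp)
  have hbl : ∀ y ∈ ({x, b, b₁, b₂} : Finset Ω), y ∈ ({a, b, c, d} : Finset Ω) → y = b := by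
    intro y hy hy'
    by_contra hne
    exact hx (h.line_unique hb hl hne hy (by simp) hy' (by simp) ▸ by simp)
  have hab : ∀ y ∈ ({x, a, a₁, a₂} : Finset Ω), y ∈ ({x, b, b₁, b₂} : Finset Ω) → y = x := by
    intro y hy hy'
    by_contra hne
    have := h.line_unique ha hb hne hy (by simp) hy' (by simp)
    exact dl.1.symm (hal b (this ▸ by simp) (by simp))
  simp only [Finset.mem_insert, Finset.mem_singleton, forall_eq_or_imp, forall_eq] at hal hbl hab hx
  simp only [List.nodup_cons, List.mem_cons, List.not_mem_nil, not_or]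
  grind

/-- Around a triangle `x, a, b` with pairwise different sides, the closed move sequence
`[x, a, b, x]` is a product of four transpositions. -/
theorem IsTwoDesign.triangle_mem (h : IsTwoDesign B 1) {x a a₁ a₂ b b₁ b₂ c d : Ω}
    (ha : ({x, a, a₁, a₂} : Finset Ω) ∈ B) (hb : ({x, b, b₁, b₂} : Finset Ω) ∈ B)
    (hl : ({a, b, c, d} : Finset Ω) ∈ B) (hx : x ∉ ({a, b, c, d} : Finset Ω)) :
    swap a b * (swap c d * swap a₁ a₂ * swap b₁ b₂) ∈ holeStabSubgroup B x := by
  have hd := h.triangle_nodup ha hb hl hx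
  simp only [List.nodup_cons, List.mem_cons, List.not_mem_nil, not_or] at hd
  have e1 := h.isElemMove ha
  have e2 := h.isElemMove hl
  have e3 : IsElemMove B b x (swap b x * swap b₁ b₂) := h.isElemMove (by rwa [Finset.insert_comm])
  refine ⟨[x, a, b, x], rfl, rfl, _, _, e1, ⟨_, _, e2, ⟨_, _, e3, rfl, rfl⟩, rfl⟩, ?_⟩
  have c1 : Commute (swap b₁ b₂) (swap a b * (swap c d * (swap x a * swap a₁ a₂))) := by
    refine Commute.mul_right ?_ (Commute.mul_right ?_ (Commute.mul_right ?_ ?_)) <;>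
      apply swap_commute <;> grind
  have c2 : Commute (swap c d) (swap x a) := by apply swap_commute <;> grind
  have c3 : swap b x * (swap a b * swap x a) = swap a b := by
    rw [mul_swap_eq_swap_mul (swap a b) x a, swap_apply_of_ne_of_ne (by grind) (by grind),
      swap_apply_left, swap_comm b x, swap_mul_self_mul]
  calc swap a b * (swap c d * swap a₁ a₂ * swap b₁ b₂)
      = swap b x * (swap a b * swap x a) * (swap c d * swap a₁ a₂ * swap b₁ b₂) := by rw [c3]
    _ = swap b x * (swap a b * ((swap x a * swap c d) * swap a₁ a₂)) * swap b₁ b₂ := by group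
    _ = swap b x * ((swap a b * (swap c d * (swap x a * swap a₁ a₂))) * swap b₁ b₂) := by
      rw [← c2.eq]; simp only [mul_assoc]
    _ = _ := by rw [← c1.eq]; simp only [mul_assoc, one_mul]

theorem IsTwoDesign.exists_perm_of_line (h : IsTwoDesign B 1) {x a b c d : Ω}
    (hl : ({a, b, c, d} : Finset Ω) ∈ B) (hx : x ∉ ({a, b, c, d} : Finset Ω)) :
    ∃ g ∈ holeStabSubgroup B x, g a = b ∧ g c = d ∧ ∀ e, e ∉ ({a, b, c, d} : Finset Ω) →
      (∀ m ∈ B, x ∈ m → e ∈ m → a ∉ m ∧ b ∉ m) → g e = e := by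
  have hxa : x ≠ a := by rintro rfl; simp at hx
  have hxb : x ≠ b := by rintro rfl; simp at hx
  obtain ⟨a₁, a₂, ha⟩ := h.exists_line hxa
  obtain ⟨b₁, b₂, hb⟩ := h.exists_line hxb
  have hd := h.triangle_nodup ha hb hl hx
  simp only [List.nodup_cons, List.mem_cons, List.not_mem_nil, not_or] at hd
  refine ⟨_, h.triangle_mem ha hb hl hx, ?_, ?_, fun e he hm => ?_⟩
  · simp only [Perm.mul_apply, swap_apply_def]; grind
  · simp only [Perm.mul_apply, swap_apply_def]; grind
  · have h1 : e ∉ ({x, a, a₁, a₂} : Finset Ω) := fun h' => (hm _ ha (by simp) h').1 (by simp)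
    have h2 : e ∉ ({x, b, b₁, b₂} : Finset Ω) := fun h' => (hm _ hb (by simp) h').2 (by simp)
    simp only [Finset.mem_insert, Finset.mem_singleton, not_or] at he h1 h2
    simp [swap_apply_of_ne_of_ne, he, h1, h2]

theorem IsTwoDesign.card_union_lines (h : IsTwoDesign B 1) {x a y z : Ω} {m₁ m₂ m₃ m₄ m₅ : Finset Ω}
    (h₁ : m₁ ∈ B) (h₂ : m₂ ∈ B) (h₃ : m₃ ∈ B) (h₄ : m₄ ∈ B) (h₅ : m₅ ∈ B)
    (hx : x ∈ m₁) (ha : a ∈ m₁) (hxy : x ≠ y) (hay : a ≠ y) (hxz : x ≠ z) (haz : a ≠ z)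
    (hx₂ : x ∈ m₂) (hy₂ : y ∈ m₂) (ha₃ : a ∈ m₃) (hy₃ : y ∈ m₃)
    (hx₄ : x ∈ m₄) (hz₄ : z ∈ m₄) (ha₅ : a ∈ m₅) (hz₅ : z ∈ m₅) :
    (m₁ ∪ m₂ ∪ m₃ ∪ m₄ ∪ m₅).card ≤ 14 := by
  have aux : ∀ {m : Finset Ω} {p q : Ω}, m ∈ B → p ≠ q → p ∈ m → q ∈ m →
      ((m.erase p).erase q).card = 2 := by
    intro m p q hm hpq hp hq
    rw [Finset.card_erase_of_mem (Finset.mem_erase.2 ⟨hpq.symm, hq⟩), Finset.card_erase_of_mem hp,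
      h.1 m hm]
  have c1 := h.1 _ h₁
  have c2 := aux h₂ hxy hx₂ hy₂
  have c3 := aux h₃ hay ha₃ hy₃
  have c4 := aux h₄ hxz hx₄ hz₄
  have c5 := aux h₅ haz ha₅ hz₅
  have cyz : ({y, z} : Finset Ω).card ≤ 2 := Finset.card_le_two
  have hsub : m₁ ∪ m₂ ∪ m₃ ∪ m₄ ∪ m₅ ⊆ m₁ ∪ (m₂.erase x).erase y ∪ (m₃.erase a).erase y ∪
      (m₄.erase x).erase z ∪ (m₅.erase a).erase z ∪ {y, z} := by
    intro w
    simp only [Finset.mem_union, Finset.mem_erase, Finset.mem_insert, Finset.mem_singleton]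
    grind
  refine (Finset.card_le_card hsub).trans ?_
  grind [Finset.card_union_le]

theorem IsTwoDesign.exists_mem_line (h : IsTwoDesign B 1) {p q : Ω} (hpq : p ≠ q) :
    ∃ m ∈ B, p ∈ m ∧ q ∈ m := by
  obtain ⟨r, s, hm⟩ := h.exists_line hpq
  exact ⟨_, hm, by simp, by simp⟩

theorem IsTwoDesign.exists_perm_off_line (h : IsTwoDesign B 1) (hcard : 16 ≤ Fintype.card Ω)
    {x a y z : Ω} {m : Finset Ω} (hm : m ∈ B) (hxa : x ≠ a) (hx : x ∈ m) (ha : a ∈ m)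
    (hy : y ∉ m) (hz : z ∉ m) : ∃ g ∈ holeStabSubgroup B x, g y = z ∧ g a = a := by
  have ne_of {u v : Ω} {k : Finset Ω} (hu : u ∈ k) (hv : v ∉ k) : u ≠ v := fun e => hv (e ▸ hu)
  have adj : ∀ {u w : Ω} {k k' : Finset Ω}, u ∉ m → w ∉ m → k ∈ B → k' ∈ B → x ∈ k → u ∈ k →
      a ∈ k' → u ∈ k' → w ∉ k → w ∉ k' →
      (∃ g ∈ holeStabSubgroup B x, g u = w ∧ g a = a) := by
    intro u w k k' hu hw hk hk' hxk huk hak' huk' hwk hwk'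
    have huw : u ≠ w := ne_of huk hwk
    obtain ⟨c, d, hl⟩ := h.exists_line huw
    have hxl : x ∉ ({u, w, c, d} : Finset Ω) := fun hxl => hwk
      (h.line_unique hl hk (ne_of hx hu) hxl (by simp) hxk huk ▸ by simp)
    have hal : a ∉ ({u, w, c, d} : Finset Ω) := fun hal => hwk'
      (h.line_unique hl hk' (ne_of ha hu) hal (by simp) hak' huk' ▸ by simp)
    obtain ⟨g, hg, hguw, -, hge⟩ := h.exists_perm_of_line hl hxl
    refine ⟨g, hg, hguw, hge a hal fun m' hm' hxm' ham' => ?_⟩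
    obtain rfl := h.line_unique hm' hm hxa hxm' ham' hx ha
    exact ⟨hu, hw⟩
  obtain ⟨m₂, h₂, hx₂, hy₂⟩ := h.exists_mem_line (ne_of hx hy)
  obtain ⟨m₃, h₃, ha₃, hy₃⟩ := h.exists_mem_line (ne_of ha hy)
  obtain ⟨m₄, h₄, hx₄, hz₄⟩ := h.exists_mem_line (ne_of hx hz)
  obtain ⟨m₅, h₅, ha₅, hz₅⟩ := h.exists_mem_line (ne_of ha hz)
  have hc := h.card_union_lines hm h₂ h₃ h₄ h₅ hx ha (ne_of hx hy) (ne_of ha hy) (ne_of hx hz)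
    (ne_of ha hz) hx₂ hy₂ ha₃ hy₃ hx₄ hz₄ ha₅ hz₅
  obtain ⟨w, -, hw⟩ := Finset.exists_mem_notMem_of_card_lt_card
    (t := (Finset.univ : Finset Ω)) (hc.trans_lt (by rw [Finset.card_univ]; omega))
  simp only [Finset.mem_union, not_or] at hw
  obtain ⟨⟨⟨⟨w1, w2⟩, w3⟩, w4⟩, w5⟩ := hw
  obtain ⟨g, hg, hgy, hga⟩ := adj hy w1 h₂ h₃ hx₂ hy₂ ha₃ hy₃ w2 w3
  obtain ⟨k, hk, hkz, hka⟩ := adj hz w1 h₄ h₅ hx₄ hz₄ ha₅ hz₅ w4 w5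
  refine ⟨k⁻¹ * g, mul_mem (inv_mem hk) hg, ?_, ?_⟩
  · rw [Perm.mul_apply, hgy, Perm.inv_eq_iff_eq, hkz]
  · rw [Perm.mul_apply, hga, Perm.inv_eq_iff_eq, hka]

/-- Two points different from the hole `x` and from `a` are exchanged by an element of the hole
stabilizer fixing `a`. -/
theorem IsTwoDesign.exists_perm_fixing (h : IsTwoDesign B 1) (hcard : 16 ≤ Fintype.card Ω)
    {x a y z : Ω} (hxa : x ≠ a) (hyx : y ≠ x) (hya : y ≠ a) (hzx : z ≠ x) (hza : z ≠ a) :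
    ∃ g ∈ holeStabSubgroup B x, g y = z ∧ g a = a := by
  obtain ⟨m, hm, hx, ha⟩ := h.exists_mem_line hxa
  have ne_of {u v : Ω} {k : Finset Ω} (hu : u ∈ k) (hv : v ∉ k) : u ≠ v := fun e => hv (e ▸ hu)
  have leave : ∀ u, u ≠ x → u ≠ a → ∃ g ∈ holeStabSubgroup B x, g u ∉ m ∧ g a = a := by
    intro u hux hua
    by_cases hum : u ∈ m
    swap
    · exact ⟨1, one_mem _, hum, rfl⟩
    obtain ⟨w, -, hw⟩ := Finset.exists_mem_notMem_of_card_lt_card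
      (t := (Finset.univ : Finset Ω)) (s := m) (by rw [h.1 m hm, Finset.card_univ]; omega)
    obtain ⟨c, d, hl⟩ := h.exists_line (ne_of hum hw)
    have meet : ∀ e ∈ ({u, w, c, d} : Finset Ω), e ∈ m → e = u := by
      intro e he hem
      by_contra hne
      exact hw (h.line_unique hl hm hne he (by simp) hem hum ▸ by simp)
    have hd := h.line_distinct hl
    have hl' : ({w, c, u, d} : Finset Ω) ∈ B := by
      convert hl using 1
      ext e; simp only [Finset.mem_insert, Finset.mem_singleton]; tauto
    have hsub : ({w, c, u, d} : Finset Ω) = {u, w, c, d} := by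
      ext e; simp only [Finset.mem_insert, Finset.mem_singleton]; tauto
    obtain ⟨g, hg, -, hgu, hge⟩ := h.exists_perm_of_line (x := x) hl'
      (fun hx' => hux (meet x (hsub ▸ hx') hx).symm)
    refine ⟨g, hg, ?_, hge a (fun ha' => hua (meet a (hsub ▸ ha') ha).symm) ?_⟩
    · rw [hgu]
      exact fun hdm => hd.2.2.1 (meet d (by simp) hdm).symm
    · intro m' hm' hxm' ham'
      obtain rfl := h.line_unique hm' hm hxa hxm' ham' hx ha
      exact ⟨hw, fun hcm => hd.2.1 (meet c (by simp) hcm).symm⟩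
  obtain ⟨g, hg, hgy, hga⟩ := leave y hyx hya
  obtain ⟨k, hk, hkz, hka⟩ := leave z hzx hza
  obtain ⟨f, hf, hfy, hfa⟩ := h.exists_perm_off_line hcard hm hxa hx ha hgy hkz
  refine ⟨k⁻¹ * (f * g), mul_mem (inv_mem hk) (mul_mem hf hg), ?_, ?_⟩
  · rw [Perm.mul_apply, Perm.mul_apply, hfy, Perm.inv_eq_iff_eq]
  · rw [Perm.mul_apply, Perm.mul_apply, hga, hfa, Perm.inv_eq_iff_eq, hka]

theorem mul_mul_mul_pow_two_of_commute {G : Type*} [Group G] {f g k l : G}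
    (hfk : Commute f k) (hfl : Commute f l) (hgk : Commute g k) (hgl : Commute g l)
    (hkl : Commute k l) (hk : k ^ 2 = 1) (hl : l ^ 2 = 1) :
    (f * k * (g * l)) ^ 2 = (f * g) ^ 2 := by
  rw [mul_assoc f, ← mul_assoc k, ← hgk.eq, mul_assoc g, ← mul_assoc f,
    ((hfk.mul_right hfl).mul_left (hgk.mul_right hgl)).mul_pow, hkl.mul_pow, hk, hl, one_mul,
    mul_one]

/-- The lines `{a, b, p, q}` and `{a, c, u, v}` give a 3-cycle in the hole stabilizer as soon as
`c` is not collinear with `x` and a point of the first one, nor `b` with `x` and a point of the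
second one. -/
theorem IsTwoDesign.threeCycle_mem (h : IsTwoDesign B 1) {x a b c p q u v : Ω}
    (hl : ({a, b, p, q} : Finset Ω) ∈ B) (hxl : x ∉ ({a, b, p, q} : Finset Ω))
    (hm : ({a, c, u, v} : Finset Ω) ∈ B) (hxm : x ∉ ({a, c, u, v} : Finset Ω))
    (hc : ∀ k ∈ B, x ∈ k → c ∈ k → b ∉ k ∧ p ∉ k ∧ q ∉ k)
    (hb : ∀ k ∈ B, x ∈ k → b ∈ k → c ∉ k ∧ u ∉ k ∧ v ∉ k) :
    (swap a b * swap a c) ^ 2 ∈ holeStabSubgroup B x := by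
  have hxa : x ≠ a := by rintro rfl; simp at hxl
  have hxb : x ≠ b := by rintro rfl; simp at hxl
  have hxc : x ≠ c := by rintro rfl; simp at hxm
  obtain ⟨a₁, a₂, ka⟩ := h.exists_line hxa
  obtain ⟨b₁, b₂, kb⟩ := h.exists_line hxb
  obtain ⟨c₁, c₂, kc⟩ := h.exists_line hxc
  have hs := h.triangle_mem ka kb hl hxl
  have ht := h.triangle_mem ka kc hm hxm
  have ds := h.triangle_nodup ka kb hl hxl
  have dt := h.triangle_nodup ka kc hm hxm
  have db := hb _ kb (by simp) (by simp)
  have dc := hc _ kc (by simp) (by simp)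
  have hbc : ∀ y ∈ ({x, b, b₁, b₂} : Finset Ω), y ∈ ({x, c, c₁, c₂} : Finset Ω) → y = x := by
    intro y hy hy'
    by_contra hne
    exact dc.1 (h.line_unique kb kc hne hy (by simp) hy' (by simp) ▸ by simp)
  have hlm : ∀ y ∈ ({a, b, p, q} : Finset Ω), y ∈ ({a, c, u, v} : Finset Ω) → y = a := by
    intro y hy hy'
    by_contra hne
    have : c ∈ ({a, b, p, q} : Finset Ω) :=
      h.line_unique hl hm hne hy (by simp) hy' (by simp) ▸ by simp
    have hcc : c ∈ ({x, c, c₁, c₂} : Finset Ω) := by simp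
    simp only [Finset.mem_insert, Finset.mem_singleton, List.nodup_cons, List.mem_cons] at this dc dt
    grind
  simp only [Finset.mem_insert, Finset.mem_singleton, List.nodup_cons, List.mem_cons,
    List.not_mem_nil, not_or, forall_eq_or_imp, forall_eq] at ds dt db dc hbc hlm
  have sq : ∀ {i j k l r s : Ω}, Commute (swap i j) (swap k l) → Commute (swap i j) (swap r s) →
      Commute (swap k l) (swap r s) → (swap i j * swap k l * swap r s) ^ 2 = 1 := by
    intro i j k l r s h1 h2 h3
    rw [(h2.mul_left h3).mul_pow, h1.mul_pow]
    simp [pow_two]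
  rw [← mul_mul_mul_pow_two_of_commute (f := swap a b) (g := swap a c)
    (k := swap p q * swap a₁ a₂ * swap b₁ b₂) (l := swap u v * swap a₁ a₂ * swap c₁ c₂)]
  · exact pow_mem (mul_mem hs ht) 2
  · refine Commute.mul_right (Commute.mul_right ?_ ?_) ?_ <;> apply swap_commute <;> grind
  · refine Commute.mul_right (Commute.mul_right ?_ ?_) ?_ <;> apply swap_commute <;> grind
  · refine Commute.mul_right (Commute.mul_right ?_ ?_) ?_ <;> apply swap_commute <;> grind
  · refine Commute.mul_right (Commute.mul_right ?_ ?_) ?_ <;> apply swap_commute <;> grind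
  · refine Commute.mul_right (Commute.mul_right ?_ ?_) ?_ <;>
      refine Commute.mul_left (Commute.mul_left ?_ ?_) ?_ <;>
      first | exact Commute.refl _ | (apply swap_commute <;> grind)
  · apply sq <;> apply swap_commute <;> grind
  · apply sq <;> apply swap_commute <;> grind

theorem IsTwoDesign.exists_threeCycle (h : IsTwoDesign B 1) (hcard : 16 ≤ Fintype.card Ω) (x : Ω) :
    ∃ a b c : Ω, x ≠ a ∧ x ≠ b ∧ x ≠ c ∧ a ≠ b ∧ a ≠ c ∧ b ≠ c ∧
      (swap a b * swap a c) ^ 2 ∈ holeStabSubgroup B x := by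
  have avoid : ∀ s : Finset Ω, s.card < 16 → ∃ w, w ∉ s := fun s hs => by
    obtain ⟨w, -, hw⟩ := Finset.exists_mem_notMem_of_card_lt_card
      (t := (Finset.univ : Finset Ω)) (s := s) (by rw [Finset.card_univ]; omega)
    exact ⟨w, hw⟩
  obtain ⟨a, hxa⟩ := avoid {x} (by simp)
  replace hxa : x ≠ a := fun e => hxa (by simp [e])
  obtain ⟨ma, hma, hxma, hama⟩ := h.exists_mem_line hxa
  obtain ⟨b, hbma⟩ := avoid ma (by rw [h.1 _ hma]; norm_num)
  have hab : a ≠ b := fun e => hbma (e ▸ hama)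
  obtain ⟨p, q, hl⟩ := h.exists_line hab
  have dl := h.line_distinct hl
  have hxl : x ∉ ({a, b, p, q} : Finset Ω) := fun hx => hbma
    (h.line_unique hl hma hxa hx (by simp) hxma hama ▸ by simp)
  have hx' := hxl
  simp only [Finset.mem_insert, Finset.mem_singleton, not_or] at hx'
  obtain ⟨-, hxb, hxp, hxq⟩ := hx'
  obtain ⟨mb, hmb, hxmb, hbmb⟩ := h.exists_mem_line hxb
  obtain ⟨mp, hmp, hxmp, hpmp⟩ := h.exists_mem_line hxp
  obtain ⟨mq, hmq, hxmq, hqmq⟩ := h.exists_mem_line hxq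
  have hunion : (insert x (ma.erase x ∪ mb.erase x ∪ mp.erase x ∪ mq.erase x)).card ≤ 13 := by
    have c1 := Finset.card_erase_of_mem hxma
    have c2 := Finset.card_erase_of_mem hxmb
    have c3 := Finset.card_erase_of_mem hxmp
    have c4 := Finset.card_erase_of_mem hxmq
    rw [h.1 _ hma] at c1
    rw [h.1 _ hmb] at c2
    rw [h.1 _ hmp] at c3
    rw [h.1 _ hmq] at c4
    grind [Finset.card_union_le, Finset.card_insert_le]
  obtain ⟨c, hc⟩ := avoid _ (hunion.trans_lt (by norm_num))
  simp only [Finset.mem_insert, Finset.mem_union, Finset.mem_erase, not_or, not_and] at hc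
  obtain ⟨hcx, ⟨⟨hca, hcb⟩, hcp⟩, hcq⟩ := hc
  replace hca := hca hcx
  replace hcb := hcb hcx
  replace hcp := hcp hcx
  replace hcq := hcq hcx
  have hac : a ≠ c := fun e => hca (e ▸ hama)
  obtain ⟨u, v, hm⟩ := h.exists_line hac
  have hxm : x ∉ ({a, c, u, v} : Finset Ω) := fun hx => hca
    (h.line_unique hm hma hxa hx (by simp) hxma hama ▸ by simp)
  have meet : ∀ {y z : Ω} {k k' : Finset Ω}, y ≠ z → y ∈ ({a, b, p, q} : Finset Ω) →
      z ∈ ({a, b, p, q} : Finset Ω) → k ∈ B → k' ∈ B → x ∈ k → x ∈ k' → y ∈ k → z ∈ k' →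
      ∀ e, e ≠ x → e ∈ k → e ∉ k' := by
    intro y z k k' hyz hy hz hk hk' hxk hxk' hyk hzk' e hex hek hek'
    obtain rfl := h.line_unique hk hk' hex hek hxk hek' hxk'
    exact hxl (h.line_unique hk hl hyz hyk hzk' hy hz ▸ hxk)
  have conclude : ∀ {y z w : Ω} {ky kz kw : Finset Ω}, ({a, y, z, w} : Finset Ω) ∈ B →
      x ∉ ({a, y, z, w} : Finset Ω) → ky ∈ B → kz ∈ B → kw ∈ B → x ∈ ky → x ∈ kz → x ∈ kw →
      y ∈ ky → z ∈ kz → w ∈ kw → c ∉ ky → c ∉ kz → c ∉ kw → u ∉ ky → v ∉ ky →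
      ∃ a b c : Ω, x ≠ a ∧ x ≠ b ∧ x ≠ c ∧ a ≠ b ∧ a ≠ c ∧ b ≠ c ∧
        (swap a b * swap a c) ^ 2 ∈ holeStabSubgroup B x := by
    intro y z w ky kz kw hl hxl hky hkz hkw hxy hxz hxw hy hz hw hcy hcz hcw huy hvy
    have hx' := hxl
    simp only [Finset.mem_insert, Finset.mem_singleton, not_or] at hx'
    refine ⟨a, y, c, hxa, hx'.2.1, Ne.symm hcx, (h.line_distinct hl).1, hac,
      fun e => hcy (e ▸ hy), h.threeCycle_mem hl hxl hm hxm ?_ ?_⟩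
    · refine fun k hk hxk hck => ⟨fun hk' => hcy ?_, fun hk' => hcz ?_, fun hk' => hcw ?_⟩
      · rwa [← h.line_unique hk hky hx'.2.1 hxk hk' hxy hy]
      · rwa [← h.line_unique hk hkz hx'.2.2.1 hxk hk' hxz hz]
      · rwa [← h.line_unique hk hkw hx'.2.2.2 hxk hk' hxw hw]
    · intro k hk hxk hyk
      obtain rfl := h.line_unique hk hky hx'.2.1 hxk hyk hxy hy
      exact ⟨hcy, huy, hvy⟩
  have hbp := meet dl.2.2.2.1 (by simp) (by simp) hmb hmp hxmb hxmp hbmb hpmp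
  have hbq := meet dl.2.2.2.2.1 (by simp) (by simp) hmb hmq hxmb hxmq hbmb hqmq
  have hpq := meet dl.2.2.2.2.2 (by simp) (by simp) hmp hmq hxmp hxmq hpmp hqmq
  have hxm' := hxm
  simp only [Finset.mem_insert, Finset.mem_singleton, not_or] at hxm'
  have hsplit : (u ∉ mb ∧ v ∉ mb) ∨ (u ∉ mp ∧ v ∉ mp) ∨ (u ∉ mq ∧ v ∉ mq) := by
    have := hbp u; have := hbq u; have := hpq u
    have := hbp v; have := hbq v; have := hpq v
    grind
  have e₁ : ({a, p, b, q} : Finset Ω) = {a, b, p, q} := by rw [Finset.insert_comm p b]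
  have e₂ : ({a, q, b, p} : Finset Ω) = {a, b, p, q} := by
    rw [Finset.insert_comm q b, Finset.pair_comm q p]
  rcases hsplit with ⟨hu, hv⟩ | ⟨hu, hv⟩ | ⟨hu, hv⟩
  · exact conclude hl hxl hmb hmp hmq hxmb hxmp hxmq hbmb hpmp hqmq hcb hcp hcq hu hv
  · exact conclude (e₁ ▸ hl) (e₁ ▸ hxl) hmp hmb hmq hxmp hxmb hxmq hpmp hbmb hqmq hcp hcb hcq hu hv
  · exact conclude (e₂ ▸ hl) (e₂ ▸ hxl) hmq hmb hmp hxmq hxmb hxmp hqmq hbmb hpmp hcq hcb hcp hu hv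

theorem IsTwoDesign.apply_eq_of_mem_holeStab (h : IsTwoDesign B 1) {x : Ω} {g : Perm Ω}
    (hg : g ∈ holeStab B x) : g x = x ∧ Perm.sign g = 1 := by
  obtain ⟨l, hl, hl', hg⟩ := hg
  obtain ⟨h1, h2⟩ := h.isMoveSeq hg
  exact ⟨by simpa [hl, hl', eq_comm] using h2 x, h1⟩

theorem ofSubtype_subtypePerm_of_apply_eq {x : Ω} {g : Perm Ω} (hg : g x = x)
    (hp : ∀ y, g y ≠ x ↔ y ≠ x) :
    Perm.ofSubtype (g.subtypePerm (p := fun y => y ≠ x) hp) = g :=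
  Perm.ofSubtype_subtypePerm hp fun y hy => by rintro rfl; exact hy hg

theorem apply_ne_iff_of_apply_eq {x : Ω} {g : Perm Ω} (hg : g x = x) (y : Ω) :
    g y ≠ x ↔ y ≠ x := by
  rw [not_iff_not]
  exact ⟨fun hy => g.injective (hy.trans hg.symm), fun hy => hy ▸ hg⟩

/-- The action of the hole stabilizer on the points different from the hole. -/
abbrev holeStabRestrict (B : Finset (Finset Ω)) (x : Ω) : Subgroup (Perm {y // y ≠ x}) :=
  (holeStabSubgroup B x).comap Perm.ofSubtype

theorem IsTwoDesign.isPreprimitive (h : IsTwoDesign B 1) (hcard : 16 ≤ Fintype.card Ω) (x : Ω) :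
    MulAction.IsPreprimitive (holeStabRestrict B x) {y // y ≠ x} := by
  have fixing : ∀ {a y z : {y // y ≠ x}}, y ≠ a → z ≠ a →
      ∃ g : holeStabRestrict B x, g • y = z ∧ g • a = a := by
    rintro ⟨a, ha⟩ ⟨y, hy⟩ ⟨z, hz⟩ hya hza
    obtain ⟨g, hg, hgy, hga⟩ := h.exists_perm_fixing hcard (Ne.symm ha) hy
      (by simpa using hya) hz (by simpa using hza)
    have hgx := (h.apply_eq_of_mem_holeStab hg).1
    refine ⟨⟨g.subtypePerm (apply_ne_iff_of_apply_eq hgx), ?_⟩, Subtype.ext hgy, Subtype.ext hga⟩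
    rwa [Subgroup.mem_comap, ofSubtype_subtypePerm_of_apply_eq hgx]
  refine MulAction.isPreprimitive_of_is_two_pretransitive
    (MulAction.is_two_pretransitive_iff.2 fun {a b c d} hab hcd => ?_)
  obtain ⟨e, -, he⟩ := Finset.exists_mem_notMem_of_card_lt_card
    (t := (Finset.univ : Finset Ω)) (s := {x, a.1, c.1})
    (by rw [Finset.card_univ]; exact Finset.card_le_three.trans_lt (by omega))
  simp only [Finset.mem_insert, Finset.mem_singleton, not_or] at he
  obtain ⟨g, hga, -⟩ := fixing (a := ⟨e, he.1⟩) (y := a) (z := c)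
    (fun h' => he.2.1 (by rw [h'])) (fun h' => he.2.2 (by rw [h']))
  have hgb : g • b ≠ c := fun h' => hab (smul_left_cancel g (hga.trans h'.symm))
  obtain ⟨k, hkb, hkc⟩ := fixing hgb hcd.symm
  exact ⟨k * g, by rw [mul_smul, hga, hkc], by rw [mul_smul, hkb]⟩

theorem IsTwoDesign.alternatingGroup_le (h : IsTwoDesign B 1) (hcard : 16 ≤ Fintype.card Ω)
    (x : Ω) : alternatingGroup {y // y ≠ x} ≤ holeStabRestrict B x := by
  obtain ⟨a, b, c, hxa, hxb, hxc, hab, hac, hbc, hmem⟩ := h.exists_threeCycle hcard x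
  refine Perm.alternatingGroup_le_of_isPreprimitive_of_isThreeCycle_mem (h.isPreprimitive hcard x)
    (Perm.isThreeCycle_swap_mul_swap_same (a := (⟨a, hxa.symm⟩ : {y // y ≠ x}))
      (b := ⟨b, hxb.symm⟩) (c := ⟨c, hxc.symm⟩) (by simpa) (by simpa) (by simpa)).isThreeCycle_sq ?_
  rw [Subgroup.mem_comap, ← pow_two]
  simpa only [map_pow, map_mul, Perm.ofSubtype_swap_eq] using hmem

end SteinerSystem

/-- (Theorem C(a)) For a supersimple 2-(n,4,1) design with `n ≥ 7`:
`n ≡ 1, 4 (mod 12)`, and if `n ≠ 13` then every hole stabilizer is exactly the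
alternating group on `Ω \ {∞}`. -/
theorem stmt5 (B : Finset (Finset Ω)) (n : ℕ) (hn : Fintype.card Ω = n) (hn7 : 7 ≤ n)
    (hdes : IsTwoDesign B 1) (hss : HGSupersimple B) :
    (n % 12 = 1 ∨ n % 12 = 4) ∧
    (n ≠ 13 → ∀ x : Ω, holeStab B x =
      { g : Equiv.Perm Ω | g x = x ∧ Equiv.Perm.sign g = 1 }) := by
  subst hn
  have : Nonempty Ω := Fintype.card_pos_iff.1 (by omega)
  have hmod := hdes.card_mod_twelve
  refine ⟨hmod, fun h13 x => Set.Subset.antisymm (fun g hg => hdes.apply_eq_of_mem_holeStab hg) ?_⟩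
  rintro g ⟨hgx, hg⟩
  have hp := apply_ne_iff_of_apply_eq hgx
  have hof := ofSubtype_subtypePerm_of_apply_eq hgx hp
  have hmem : g.subtypePerm (p := fun y => y ≠ x) hp ∈ holeStabRestrict B x :=
    hdes.alternatingGroup_le (by omega) x
      (Perm.mem_alternatingGroup.2 (by rw [← Perm.sign_ofSubtype, hof, hg]))
  rwa [Subgroup.mem_comap, hof] at hmem
end
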